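/- Let J ⊊ I be square-free monomial ideals of S = K[x_1,...,x_n] with I generated in degrees ≥ d and J in degrees ≥ d+1, and let d ≤ t ≤ n. Set α_t = Σ_{i=0}^{t-d} (-1)^{t-d+i} ρ_{d+i}(I\J). If depth_S(I/J) ≥ t and ρ_{t+1}(I\J) < α_t, then depth_S(I/J) = t, independently of the characteristic of K. -/

import Mathlib

open MvPolynomial

/-- A squarefree exponent vector. -/
def IsSqfree {n : ℕ} (m : Fin n →₀ ℕ) : Prop := ∀ j, m j ≤ 1

/-- Total degree of an exponent vector. -/
def mdeg {n : ℕ} (m : Fin n →₀ ℕ) : ℕ := m.sum fun _ e => e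

/-- `I` is generated by squarefree monomials of degree `≥ d`. -/
def GenSqfreeGe (K : Type*) [Field K] {n : ℕ} (d : ℕ)
    (I : Ideal (MvPolynomial (Fin n) K)) : Prop :=
  ∃ G : Set (Fin n →₀ ℕ), (∀ m ∈ G, IsSqfree m ∧ d ≤ mdeg m) ∧
    I = Ideal.span ((fun m => monomial m (1 : K)) '' G)

/-- `ρ_t(I \ J)`: the number of squarefree monomials of degree `t` in `I \ J`. -/
noncomputable def rho (K : Type*) [Field K] {n : ℕ}
    (I J : Ideal (MvPolynomial (Fin n) K)) (t : ℕ) : ℕ :=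
  Set.ncard {m : Fin n →₀ ℕ | IsSqfree m ∧ mdeg m = t ∧
    monomial m (1 : K) ∈ I ∧ monomial m (1 : K) ∉ J}

/-- The `S`-module `I/J`. -/
abbrev quotMod {K : Type*} [Field K] {n : ℕ}
    (I J : Ideal (MvPolynomial (Fin n) K)) :=
  I ⧸ (Submodule.comap I.subtype (J : Submodule (MvPolynomial (Fin n) K) (MvPolynomial (Fin n) K)))

/-- Depth of a module over `K[x_1,…,x_n]` w.r.t. the maximal graded ideal
`(x_1,…,x_n)`: the supremum of lengths of regular sequences on `M` from it. -/
noncomputable def mdepth (K : Type*) [Field K] (n : ℕ)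
    (M : Type*) [AddCommGroup M] [Module (MvPolynomial (Fin n) K) M] : ℕ :=
  sSup {k | ∃ rs : List (MvPolynomial (Fin n) K), rs.length = k ∧
    (∀ r ∈ rs, r ∈ Ideal.span (Set.range (X : Fin n → MvPolynomial (Fin n) K))) ∧
    RingTheory.Sequence.IsRegular M rs}

section Koszul

variable {n : ℕ}

/-- The sign attached to the position of `i` relative to the elements of `F`. -/
def koszulSign (i : Fin n) (F : Finset (Fin n)) : ℤ :=
  ∏ l ∈ F, if l < i then -1 else 1

lemma koszulSign_mul_self (i : Fin n) (F : Finset (Fin n)) :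
    koszulSign i F * koszulSign i F = 1 := by
  rw [koszulSign, ← Finset.prod_mul_distrib]
  exact Finset.prod_eq_one fun l _ => by split_ifs <;> rfl

lemma koszulSign_eq_mul_erase {i j : Fin n} {F : Finset (Fin n)} (hj : j ∈ F) :
    koszulSign i F = (if j < i then -1 else 1) * koszulSign i (F.erase j) :=
  (Finset.mul_prod_erase F _ hj).symm

lemma koszulSign_erase_self (i : Fin n) (F : Finset (Fin n)) :
    koszulSign i (F.erase i) = koszulSign i F := by
  by_cases hi : i ∈ F
  · simp [koszulSign_eq_mul_erase hi]
  · rw [Finset.erase_eq_of_notMem hi]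

lemma koszulSign_swap {i j : Fin n} {F : Finset (Fin n)} (hi : i ∈ F) (hj : j ∈ F)
    (hij : i ≠ j) :
    koszulSign j F * koszulSign i (F.erase j) = -(koszulSign i F * koszulSign j (F.erase i)) := by
  rw [koszulSign_eq_mul_erase (i := j) hi, koszulSign_eq_mul_erase (i := i) hj]
  rcases lt_or_gt_of_ne hij with h | h <;> simp [h, h.not_gt, mul_comm]

variable {R : Type*} [CommRing R] {M : Type*} [AddCommGroup M] [Module R M]

/-- The differential of the Koszul cochain complex of `x` with coefficients in `M`. A cochain
of degree `k` is a function on finsets vanishing off those of cardinality `k`. -/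
def koszulD (M : Type*) [AddCommGroup M] [Module R M] (x : Fin n → R) :
    (Finset (Fin n) → M) →ₗ[R] (Finset (Fin n) → M) where
  toFun m F := ∑ j ∈ F, koszulSign j F • x j • m (F.erase j)
  map_add' a b := by
    funext F
    simp [smul_add, Finset.sum_add_distrib]
  map_smul' r a := by
    funext F
    simp only [Pi.smul_apply, RingHom.id_apply, Finset.smul_sum]
    refine Finset.sum_congr rfl fun j _ => ?_
    rw [smul_comm r (koszulSign j F), smul_comm r (x j)]

lemma koszulD_apply (x : Fin n → R) (m : Finset (Fin n) → M) (F : Finset (Fin n)) :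
    koszulD M x m F = ∑ j ∈ F, koszulSign j F • x j • m (F.erase j) := rfl

lemma koszulD_comp_linearMap {N : Type*} [AddCommGroup N] [Module R N] (f : M →ₗ[R] N)
    (x : Fin n → R) (m : Finset (Fin n) → M) :
    koszulD N x (f ∘ m) = f ∘ koszulD M x m := by
  funext F
  simp [koszulD_apply]

lemma koszulD_koszulD (x : Fin n → R) (m : Finset (Fin n) → M) :
    koszulD M x (koszulD M x m) = 0 := by
  funext F
  simp only [koszulD_apply, Finset.smul_sum, Pi.zero_apply]
  rw [Finset.sum_sigma']
  refine Finset.sum_involution (fun p _ => ⟨p.2, p.1⟩) ?_ ?_ ?_ ?_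
  · rintro ⟨j, i⟩ hp
    simp only [Finset.mem_sigma, Finset.mem_erase] at hp
    obtain ⟨hj, hij, hi⟩ := hp
    simp only [smul_comm (x _) (koszulSign _ _), smul_smul, koszulSign_swap hi hj hij,
      Finset.erase_right_comm (a := i), mul_comm (x i)]
    simp
  · rintro ⟨j, i⟩ hp _ h
    simp only [Finset.mem_sigma, Finset.mem_erase] at hp
    simp only [Sigma.mk.injEq] at h
    exact hp.2.1 h.1
  · rintro ⟨j, i⟩ hp
    simp only [Finset.mem_sigma, Finset.mem_erase] at hp ⊢
    exact ⟨hp.2.2, hp.2.1.symm, hp.1⟩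
  · rintro ⟨j, i⟩ _
    rfl

lemma exists_koszulD_eq_coord_smul (x : Fin n → R) {c : Finset (Fin n) → M} {k : ℕ}
    (hc : ∀ F, F.card ≠ k → c F = 0) (hD : koszulD M x c = 0) (j : Fin n) :
    ∃ b : Finset (Fin n) → M, (∀ F, F.card + 1 ≠ k → b F = 0) ∧ koszulD M x b = x j • c := by
  refine ⟨fun F => if j ∈ F then 0 else koszulSign j F • c (insert j F), fun F hF => ?_, ?_⟩
  · dsimp only
    split_ifs with hj
    · rfl
    · rw [hc _ (by rwa [Finset.card_insert_of_notMem hj]), smul_zero]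
  funext F
  rw [koszulD_apply, Pi.smul_apply]
  by_cases hj : j ∈ F
  · rw [Finset.sum_eq_single_of_mem j hj]
    · simp only [Finset.mem_erase, ne_eq, not_true_eq_false, false_and, if_false,
        Finset.insert_erase hj, koszulSign_erase_self]
      rw [smul_comm (x j), smul_smul, koszulSign_mul_self, one_smul]
    · intro i _ hij
      simp [hj, hij.symm]
  · have h := congrArg (koszulSign j F • ·) (congrFun hD (insert j F))
    have hε : koszulSign j (insert j F) = koszulSign j F := by
      rw [← koszulSign_erase_self, Finset.erase_insert hj]
    simp only [koszulD_apply, Finset.sum_insert hj, Finset.erase_insert hj, hε, Pi.zero_apply,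
      smul_zero, smul_add, smul_smul, koszulSign_mul_self, one_smul, Finset.smul_sum] at h
    rw [eq_neg_of_add_eq_zero_left h, ← Finset.sum_neg_distrib]
    refine Finset.sum_congr rfl fun i hi => ?_
    have hij : i ≠ j := fun e => hj (e ▸ hi)
    have hswap := koszulSign_swap (Finset.mem_insert_of_mem hi) (Finset.mem_insert_self j F) hij
    rw [hε, Finset.erase_insert hj, Finset.erase_insert_of_ne hij.symm] at hswap
    have hε' : koszulSign j (insert j (F.erase i)) = koszulSign j (F.erase i) := by
      rw [← koszulSign_erase_self, Finset.erase_insert (by simp [hj])]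
    rw [hε'] at hswap
    have hji : j ∉ F.erase i := by simp [hj]
    rw [if_neg hji, Finset.erase_insert_of_ne hij.symm, smul_comm (x i), smul_smul,
      ← neg_smul]
    congr 1
    linear_combination koszulSign j F * koszulSign j (F.erase i) * hswap -
      koszulSign i F * koszulSign j (F.erase i) * koszulSign_mul_self j F -
      koszulSign j F * koszulSign i (insert j F) * koszulSign_mul_self j (F.erase i)

lemma exists_koszulD_eq_smul (x : Fin n → R) {c : Finset (Fin n) → M} {k : ℕ}
    (hc : ∀ F, F.card ≠ k → c F = 0) (hD : koszulD M x c = 0) {r : R}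
    (hr : r ∈ Ideal.span (Set.range x)) :
    ∃ b : Finset (Fin n) → M, (∀ F, F.card + 1 ≠ k → b F = 0) ∧ koszulD M x b = r • c := by
  induction hr using Submodule.span_induction with
  | mem r hr =>
    obtain ⟨j, rfl⟩ := hr
    exact exists_koszulD_eq_coord_smul x hc hD j
  | zero => exact ⟨0, fun _ _ => rfl, by simp⟩
  | add r s _ _ ihr ihs =>
    obtain ⟨b, hb, hb'⟩ := ihr
    obtain ⟨b', hc, hc'⟩ := ihs
    exact ⟨b + b', fun F hF => by simp [hb F hF, hc F hF], by rw [map_add, hb', hc', add_smul]⟩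
  | smul a r _ ih =>
    obtain ⟨b, hb, hb'⟩ := ih
    exact ⟨a • b, fun F hF => by simp [hb F hF], by rw [map_smul, hb', smul_assoc]⟩

/-- The Koszul cohomology of `M` vanishes below the length of a weakly regular sequence in the
ideal generated by `x`. -/
lemma exists_koszulD_eq_of_isWeaklyRegular (x : Fin n → R) {rs : List R}
    (hmem : ∀ r ∈ rs, r ∈ Ideal.span (Set.range x))
    (hreg : RingTheory.Sequence.IsWeaklyRegular M rs) {k : ℕ} (hk : k < rs.length)
    {c : Finset (Fin n) → M} (hc : ∀ F, F.card ≠ k → c F = 0) (hD : koszulD M x c = 0) :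
    ∃ b, koszulD M x b = c := by
  induction rs generalizing M k with
  | nil => simp at hk
  | cons r rs ih =>
    rw [RingTheory.Sequence.isWeaklyRegular_cons_iff] at hreg
    obtain ⟨hr, hrs⟩ := hreg
    have hinj : ∀ {u v : Finset (Fin n) → M}, r • u = r • v → u = v := fun h =>
      funext fun F => hr (congrFun h F)
    obtain ⟨b, hb, hbc⟩ := exists_koszulD_eq_smul x hc hD (hmem r (by simp))
    rcases k with _ | k
    · have : b = 0 := funext fun F => hb F (by omega)
      refine ⟨0, hinj ?_⟩
      rw [← hbc, this, map_zero, smul_zero]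
    let q : M →ₗ[R] QuotSMulTop r M := Submodule.mkQ _
    have hq : ∀ m : M, q m = 0 ↔ ∃ m', r • m' = m := fun m => by
      simp only [q, Submodule.mkQ_apply, Submodule.Quotient.mk_eq_zero,
        Submodule.mem_smul_pointwise_iff_exists, Submodule.mem_top, true_and]
    have hqr : ∀ m : M, q (r • m) = 0 := fun m => (hq _).2 ⟨m, rfl⟩
    obtain ⟨e, he⟩ := ih (M := QuotSMulTop r M) (k := k) (c := q ∘ b)
      (fun s hs => hmem s (by simp [hs])) hrs (by simpa using hk)
      (fun F hF => by simp [hb F (by omega)])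
      (by
        rw [koszulD_comp_linearMap, hbc]
        exact funext fun F => hqr _)
    choose e' he' using fun F => Submodule.mkQ_surjective _ (e F)
    obtain rfl : q ∘ e' = e := funext he'
    rw [koszulD_comp_linearMap] at he
    have hf : ∀ F, ∃ f, r • f = b F - koszulD M x e' F := fun F => by
      rw [← hq, map_sub, sub_eq_zero]
      exact (congrFun he F).symm
    choose f hf using hf
    have hf' : r • f = b - koszulD M x e' := funext hf
    refine ⟨f, hinj ?_⟩
    rw [← map_smul, hf', map_sub, koszulD_koszulD, sub_zero, hbc]

end Koszul

section Counting

variable {n : ℕ} (K : Type*) [Field K] (P : Finset (Fin n) → Prop)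

/-- The cochain complex of `K`-valued functions on the finsets satisfying `P`. -/
noncomputable def restrictedD (k : ℕ) :
    ({F // F.card = k ∧ P F} → K) →ₗ[K] ({F // F.card = k + 1 ∧ P F} → K) :=
  LinearMap.funLeft K K Subtype.val ∘ₗ koszulD K (fun _ => (1 : K)) ∘ₗ
    Function.ExtendByZero.linearMap K Subtype.val

variable {K P}

lemma restrictedD_apply (k : ℕ) (c : {F // F.card = k ∧ P F} → K)
    (F : {F // F.card = k + 1 ∧ P F}) :
    restrictedD K P k c F =
      koszulD K (fun _ => (1 : K)) (Function.extend Subtype.val c 0) F := rfl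

lemma extend_val_of_not {k : ℕ} (c : {F // F.card = k ∧ P F} → K) {F : Finset (Fin n)}
    (hF : ¬(F.card = k ∧ P F)) : Function.extend Subtype.val c 0 F = 0 :=
  Function.extend_apply' _ _ _ fun ⟨G, hG⟩ => hF (hG ▸ G.2)

lemma restrictedD_comp_restrictedD
    (hP : ∀ F, ∀ j ∈ F, ∀ i ∈ F.erase j, P F → P ((F.erase j).erase i) → P (F.erase j)) (k : ℕ) :
    restrictedD K P (k + 1) ∘ₗ restrictedD K P k = 0 := by
  refine LinearMap.ext fun c => funext fun F => ?_
  set e : Finset (Fin n) → K := Function.extend Subtype.val c 0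
  change restrictedD K P (k + 1) (restrictedD K P k c) F = 0
  refine Eq.trans ?_ (congrFun (koszulD_koszulD (fun _ => (1 : K)) e) F)
  rw [restrictedD_apply, koszulD_apply, koszulD_apply]
  refine Finset.sum_congr rfl fun j hj => ?_
  congr 2
  have hcard := Finset.card_erase_add_one hj
  by_cases h : (F.1.erase j).card = k + 1 ∧ P (F.1.erase j)
  · exact Subtype.val_injective.extend_apply (restrictedD K P k c) 0 ⟨_, h⟩
  rw [extend_val_of_not _ h, koszulD_apply]
  refine (Finset.sum_eq_zero fun i hi => ?_).symm
  suffices e ((F.1.erase j).erase i) = 0 by simp [this]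
  refine extend_val_of_not c fun h' => h ⟨?_, hP _ j hj i hi F.2.2 h'.2⟩
  have := F.2.1
  omega

lemma finrank_range_restrictedD {d t : ℕ} (hd : 1 ≤ d) (hdt : d ≤ t)
    (hP : ∀ F, P F → d ≤ F.card)
    (hex : ∀ k, k < t → LinearMap.ker (restrictedD K P (k + 1)) ≤
      LinearMap.range (restrictedD K P k))
    (hcomp : ∀ k, restrictedD K P (k + 1) ∘ₗ restrictedD K P k = 0) :
    (Module.finrank K (LinearMap.range (restrictedD K P t)) : ℤ) =
      ∑ i ∈ Finset.range (t - d + 1),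
        (-1 : ℤ) ^ (t - d + i) * (Nat.card {F : Finset (Fin n) // F.card = d + i ∧ P F} : ℤ) := by
  have hrank : ∀ k, k < t →
      Module.finrank K (LinearMap.range (restrictedD K P (k + 1))) +
        Module.finrank K (LinearMap.range (restrictedD K P k)) =
      Nat.card {F : Finset (Fin n) // F.card = k + 1 ∧ P F} := fun k hk => by
    classical
    have h := LinearMap.finrank_range_add_finrank_ker (restrictedD K P (k + 1))
    rw [le_antisymm (hex k hk) (LinearMap.range_le_ker_iff.2 (hcomp k)),
      Module.finrank_fintype_fun_eq_card] at h
    rw [h, Nat.card_eq_fintype_card]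
  induction t, hdt using Nat.le_induction with
  | base =>
    obtain ⟨k, rfl⟩ := Nat.exists_eq_add_of_le' hd
    have : IsEmpty {F : Finset (Fin n) // F.card = k ∧ P F} :=
      ⟨fun F => by have := hP _ F.2.2; have := F.2.1; omega⟩
    have h0 : Module.finrank K (LinearMap.range (restrictedD K P k)) = 0 :=
      Nat.le_zero.1 ((LinearMap.finrank_range_le _).trans (by
        simp [Module.finrank_zero_of_subsingleton]))
    have := hrank k (by omega)
    rw [h0] at this
    simp [← this]
  | succ t hdt ih =>
    have h := hrank t (by omega)
    have ih := ih (fun k hk => hex k (by omega)) (fun k hk => hrank k (by omega))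
    rw [show t + 1 - d + 1 = (t - d + 1) + 1 by omega, Finset.sum_range_succ,
      show d + (t - d + 1) = t + 1 by omega, show t + 1 - d = t - d + 1 by omega, ← h]
    have hs : ∀ a : ℕ, (-1 : ℤ) ^ (t - d + 1 + a) = -(-1 : ℤ) ^ (t - d + a) := fun a => by ring
    simp only [hs, neg_mul, Finset.sum_neg_distrib]
    rw [← ih, show t - d + (t - d + 1) = 2 * (t - d) + 1 by omega]
    push_cast
    simp [pow_succ, pow_mul]

end Counting

section SquarefreeMonomials

variable {n : ℕ}

/-- The exponent vector of the squarefree monomial with support `F`. -/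
noncomputable def sqfreeExp (F : Finset (Fin n)) : Fin n →₀ ℕ :=
  Finsupp.indicator F fun _ _ => 1

lemma sqfreeExp_apply (F : Finset (Fin n)) (i : Fin n) :
    sqfreeExp F i = if i ∈ F then 1 else 0 := by
  simp [sqfreeExp, Finsupp.indicator_apply]

lemma support_sqfreeExp (F : Finset (Fin n)) : (sqfreeExp F).support = F := by
  ext i
  simp [sqfreeExp_apply]

lemma sqfreeExp_injective : Function.Injective (sqfreeExp (n := n)) :=
  Function.LeftInverse.injective support_sqfreeExp

lemma sqfreeExp_support {m : Fin n →₀ ℕ} (hm : IsSqfree m) : sqfreeExp m.support = m := by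
  ext i
  have := hm i
  rw [sqfreeExp_apply]
  split_ifs with h <;> simp at h <;> omega

lemma mdeg_eq_sum (m : Fin n →₀ ℕ) : mdeg m = ∑ i, m i :=
  Finsupp.sum_fintype _ _ fun _ => rfl

lemma mdeg_sqfreeExp (F : Finset (Fin n)) : mdeg (sqfreeExp F) = F.card := by
  simp [mdeg_eq_sum, sqfreeExp_apply]

lemma sqfreeExp_erase_add_single {F : Finset (Fin n)} {j : Fin n} (hj : j ∈ F) :
    sqfreeExp (F.erase j) + Finsupp.single j 1 = sqfreeExp F := by
  ext i
  rcases eq_or_ne i j with rfl | h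
  · simp [sqfreeExp_apply, hj]
  · simp [sqfreeExp_apply, h, Finsupp.single_eq_of_ne h]

variable {K : Type*} [Field K]

lemma X_mul_monomial_erase {F : Finset (Fin n)} {j : Fin n} (hj : j ∈ F) (a : K) :
    X j * monomial (sqfreeExp (F.erase j)) a = monomial (sqfreeExp F) a := by
  rw [mul_comm, ← sqfreeExp_erase_add_single hj, monomial_add_single, pow_one]

lemma monomial_mem_of_erase_mem {I : Ideal (MvPolynomial (Fin n) K)} {F : Finset (Fin n)}
    {j : Fin n} (hj : j ∈ F) (h : monomial (sqfreeExp (F.erase j)) (1 : K) ∈ I) :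
    monomial (sqfreeExp F) (1 : K) ∈ I := by
  rw [← X_mul_monomial_erase hj]
  exact I.mul_mem_left _ h

lemma monomial_mem_of_one {I : Ideal (MvPolynomial (Fin n) K)} {m : Fin n →₀ ℕ} (a : K)
    (h : monomial m (1 : K) ∈ I) : monomial m a ∈ I := by
  rw [← mul_one a, ← C_mul_monomial]
  exact I.mul_mem_left _ h

lemma GenSqfreeGe.monomial_mem_of_coeff_ne_zero {d : ℕ} {I : Ideal (MvPolynomial (Fin n) K)}
    (hI : GenSqfreeGe K d I) {f : MvPolynomial (Fin n) K} (hf : f ∈ I) {m : Fin n →₀ ℕ}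
    (hm : coeff m f ≠ 0) : monomial m (1 : K) ∈ I := by
  obtain ⟨G, -, rfl⟩ := hI
  rw [mem_ideal_span_monomial_image] at hf ⊢
  intro m' hm'
  exact Finset.mem_singleton.1 (support_monomial_subset hm') ▸ hf m (mem_support_iff.2 hm)

lemma GenSqfreeGe.le_card {d : ℕ} {I : Ideal (MvPolynomial (Fin n) K)}
    (hI : GenSqfreeGe K d I) {F : Finset (Fin n)} (hF : monomial (sqfreeExp F) (1 : K) ∈ I) :
    d ≤ F.card := by
  obtain ⟨G, hG, rfl⟩ := hI
  rw [mem_ideal_span_monomial_image] at hF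
  obtain ⟨m, hm, hle⟩ := hF (sqfreeExp F) (by simp [mem_support_iff])
  refine (hG m hm).2.trans ?_
  rw [← mdeg_sqfreeExp, mdeg_eq_sum, mdeg_eq_sum]
  exact Finset.sum_le_sum fun i _ => hle i

lemma rho_eq_card (I J : Ideal (MvPolynomial (Fin n) K)) (k : ℕ) :
    rho K I J k = Nat.card {F : Finset (Fin n) // F.card = k ∧
      monomial (sqfreeExp F) (1 : K) ∈ I ∧ monomial (sqfreeExp F) (1 : K) ∉ J} := by
  rw [rho, ← Set.coe_ofPred, Nat.card_coe_set_eq,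
    ← Set.ncard_image_of_injective _ sqfreeExp_injective]
  congr 1
  ext m
  constructor
  · rintro ⟨hm, hdeg, hmI, hmJ⟩
    refine ⟨m.support, ?_, sqfreeExp_support hm⟩
    rw [Set.mem_ofPred_eq, sqfreeExp_support hm, ← mdeg_sqfreeExp, sqfreeExp_support hm]
    exact ⟨hdeg, hmI, hmJ⟩
  · rintro ⟨F, ⟨hF, hFI, hFJ⟩, rfl⟩
    refine ⟨fun i => ?_, (mdeg_sqfreeExp F).trans hF, hFI, hFJ⟩
    rw [sqfreeExp_apply]
    split_ifs <;> simp

end SquarefreeMonomials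

section Exactness

variable {n : ℕ} {K : Type*} [Field K] {I J : Ideal (MvPolynomial (Fin n) K)}

/-- Taking coefficients at squarefree exponents turns a primitive in the Koszul complex of
`I/J` into a primitive for the cochain complex of the squarefree monomials in `I \ J`. -/
lemma exists_primitive_of_isWeaklyRegular {d e : ℕ}
    (hI : GenSqfreeGe K d I) (hJ : GenSqfreeGe K e J) {rs : List (MvPolynomial (Fin n) K)}
    (hmem : ∀ r ∈ rs, r ∈ Ideal.span (Set.range (X : Fin n → MvPolynomial (Fin n) K)))
    (hreg : RingTheory.Sequence.IsWeaklyRegular (quotMod I J) rs) {k : ℕ} (hk : k < rs.length)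
    {c : Finset (Fin n) → K} (hcard : ∀ F, F.card ≠ k → c F = 0)
    (hcI : ∀ F, monomial (sqfreeExp F) (1 : K) ∉ I → c F = 0)
    (hc : ∀ F, F.card = k + 1 → monomial (sqfreeExp F) (1 : K) ∈ I →
      monomial (sqfreeExp F) (1 : K) ∉ J → koszulD K (fun _ => (1 : K)) c F = 0) :
    ∃ b : Finset (Fin n) → K, (∀ F, monomial (sqfreeExp F) (1 : K) ∉ I → b F = 0) ∧
      ∀ F, monomial (sqfreeExp F) (1 : K) ∉ J → koszulD K (fun _ => (1 : K)) b F = c F := by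
  let q : I →ₗ[MvPolynomial (Fin n) K] quotMod I J := Submodule.mkQ _
  have hq : ∀ f : I, q f = 0 ↔ (f : MvPolynomial (Fin n) K) ∈ J := fun f => by
    simp [q]
  let g : Finset (Fin n) → I := fun F => ⟨monomial (sqfreeExp F) (c F), by
    by_cases h : monomial (sqfreeExp F) (1 : K) ∈ I
    · exact monomial_mem_of_one _ h
    · simp [hcI F h]⟩
  have hcoe : ∀ (u : Finset (Fin n) → I) (F : Finset (Fin n)),
      (koszulD I X u F : MvPolynomial (Fin n) K) =
        koszulD (MvPolynomial (Fin n) K) X (fun G => (u G : MvPolynomial (Fin n) K)) F :=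
    fun u F => (congrFun (koszulD_comp_linearMap I.subtype X u) F).symm
  have hDg : ∀ F, (koszulD I X g F : MvPolynomial (Fin n) K) =
      monomial (sqfreeExp F) (koszulD K (fun _ => (1 : K)) c F) := fun F => by
    rw [hcoe]
    simp only [koszulD_apply, map_sum, one_smul]
    refine Finset.sum_congr rfl fun j hj => ?_
    rw [map_zsmul, ← X_mul_monomial_erase hj, smul_eq_mul]
  have hqg : koszulD (quotMod I J) (X : Fin n → MvPolynomial (Fin n) K) (q ∘ g) = 0 := by
    rw [koszulD_comp_linearMap]
    funext F
    refine (hq _).2 ?_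
    rw [hDg]
    by_cases hFJ : monomial (sqfreeExp F) (1 : K) ∈ J
    · exact monomial_mem_of_one _ hFJ
    suffices koszulD K (fun _ => (1 : K)) c F = 0 by simp [this]
    by_cases hF : F.card = k + 1 ∧ monomial (sqfreeExp F) (1 : K) ∈ I
    · exact hc F hF.1 hF.2 hFJ
    rw [koszulD_apply]
    refine Finset.sum_eq_zero fun j hj => ?_
    suffices c (F.erase j) = 0 by simp [this]
    by_contra h
    have h1 : (F.erase j).card = k := by_contra fun h' => h (hcard _ h')
    have h2 := Finset.card_erase_add_one hj
    exact hF ⟨by omega, monomial_mem_of_erase_mem hj (by_contra fun h' => h (hcI _ h'))⟩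
  obtain ⟨b, hb⟩ := exists_koszulD_eq_of_isWeaklyRegular _ hmem hreg hk
    (fun F hF => by
      refine (hq _).2 ?_
      simp [g, hcard F hF]) hqg
  choose b' hb' using fun F => Submodule.mkQ_surjective _ (b F)
  obtain rfl : q ∘ b' = b := funext hb'
  refine ⟨fun F => coeff (sqfreeExp F) (b' F : MvPolynomial (Fin n) K), fun F hF => ?_,
    fun F hF => ?_⟩
  · by_contra h
    exact hF (hI.monomial_mem_of_coeff_ne_zero (b' F).2 h)
  have hsub : ((koszulD I (X (R := K)) b' F - g F : I) : MvPolynomial (Fin n) K) ∈ J := by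
    rw [← hq, map_sub, sub_eq_zero]
    rw [koszulD_comp_linearMap] at hb
    exact congrFun hb F
  have hzero : coeff (sqfreeExp F)
      ((koszulD I (X (R := K)) b' F - g F : I) : MvPolynomial (Fin n) K) = 0 :=
    by_contra fun h => hF (hJ.monomial_mem_of_coeff_ne_zero hsub h)
  rw [Submodule.coe_sub, coeff_sub, sub_eq_zero, coeff_monomial, if_pos rfl] at hzero
  rw [← hzero, hcoe, koszulD_apply, koszulD_apply, coeff_sum]
  refine Finset.sum_congr rfl fun j hj => ?_
  rw [one_smul, ← lcoeff_apply K (sqfreeExp F), map_zsmul, lcoeff_apply, smul_eq_mul,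
    ← sqfreeExp_erase_add_single hj, mul_comm, coeff_mul_X]

lemma ker_restrictedD_le_range {d e : ℕ}
    (hI : GenSqfreeGe K d I) (hJ : GenSqfreeGe K e J) {rs : List (MvPolynomial (Fin n) K)}
    (hmem : ∀ r ∈ rs, r ∈ Ideal.span (Set.range (X : Fin n → MvPolynomial (Fin n) K)))
    (hreg : RingTheory.Sequence.IsWeaklyRegular (quotMod I J) rs) {k : ℕ}
    (hk : k + 1 < rs.length) :
    let P := fun F : Finset (Fin n) =>
      monomial (sqfreeExp F) (1 : K) ∈ I ∧ monomial (sqfreeExp F) (1 : K) ∉ J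
    LinearMap.ker (restrictedD K P (k + 1)) ≤ LinearMap.range (restrictedD K P k) := by
  intro P c hc
  obtain ⟨b, hbI, hb⟩ := exists_primitive_of_isWeaklyRegular hI hJ hmem hreg hk
    (c := Function.extend Subtype.val c 0)
    (fun F hF => extend_val_of_not c fun h => hF h.1)
    (fun F hF => extend_val_of_not c fun h => hF h.2.1)
    (fun F hF hFI hFJ => congrFun hc ⟨F, hF, hFI, hFJ⟩)
  refine ⟨fun F => b F, funext fun F => ?_⟩
  rw [← Subtype.val_injective.extend_apply c 0 F, ← hb F F.2.2.2, restrictedD_apply,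
    koszulD_apply, koszulD_apply]
  refine Finset.sum_congr rfl fun j hj => ?_
  congr 2
  have hcard := Finset.card_erase_add_one hj
  by_cases h : (F.1.erase j).card = k ∧ P (F.1.erase j)
  · exact Subtype.val_injective.extend_apply (fun G : {F // F.card = k ∧ P F} => b G) 0 ⟨_, h⟩
  rw [extend_val_of_not _ h, hbI]
  refine fun h' => h ⟨?_, h', fun hJ' => F.2.2.2 (monomial_mem_of_erase_mem hj hJ')⟩
  have := F.2.1
  omega

/-- The alternating sum of the numbers of squarefree monomials of `I \ J` in degrees `≤ t` is at
most the number of those in degree `t + 1` if `I/J` has a weakly regular sequence of length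
`t + 1` in the maximal graded ideal. -/
lemma alternating_sum_rho_le {d e t : ℕ} (hd : 1 ≤ d) (hdt : d ≤ t)
    (hI : GenSqfreeGe K d I) (hJ : GenSqfreeGe K e J) {rs : List (MvPolynomial (Fin n) K)}
    (hmem : ∀ r ∈ rs, r ∈ Ideal.span (Set.range (X : Fin n → MvPolynomial (Fin n) K)))
    (hreg : RingTheory.Sequence.IsWeaklyRegular (quotMod I J) rs) (ht : t < rs.length) :
    ∑ i ∈ Finset.range (t - d + 1), (-1 : ℤ) ^ (t - d + i) * (rho K I J (d + i) : ℤ) ≤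
      rho K I J (t + 1) := by
  classical
  simp only [rho_eq_card]
  rw [← finrank_range_restrictedD (K := K) hd hdt (fun F hF => hI.le_card hF.1)
    (fun k hk => ker_restrictedD_le_range hI hJ hmem hreg (by omega))
    (restrictedD_comp_restrictedD fun F j hj i hi hF h =>
      ⟨monomial_mem_of_erase_mem hi h.1, fun h' => hF.2 (monomial_mem_of_erase_mem hj h')⟩)]
  rw [Nat.card_eq_fintype_card, ← Module.finrank_fintype_fun_eq_card K]
  exact_mod_cast Submodule.finrank_le _

end Exactness

theorem main_upper_bound {K : Type*} [Field K] {n d t : ℕ}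
    (I J : Ideal (MvPolynomial (Fin n) K)) (hJI : J < I)
    (hI : GenSqfreeGe K d I) (hJ : GenSqfreeGe K (d + 1) J)
    (hd : 1 ≤ d) (hdt : d ≤ t) (htn : t ≤ n)
    (hdepth : t ≤ mdepth K n (quotMod I J))
    (halpha : (rho K I J (t + 1) : ℤ) <
      ∑ i ∈ Finset.range (t - d + 1),
        (-1 : ℤ) ^ (t - d + i) * (rho K I J (d + i) : ℤ)) :
    mdepth K n (quotMod I J) = t := by
  refine le_antisymm (csSup_le' ?_) hdepth
  rintro k ⟨rs, rfl, hmem, hreg⟩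
  by_contra! h
  exact (alternating_sum_rho_le hd hdt hI hJ hmem hreg.toIsWeaklyRegular h).not_gt halpha
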